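/- Let (T,*,[[·,·,·]],b) be a quadratic left Bol algebra over ℝ. On T ⊕ T* define the binary operation (x+f) ∘ (y+g) := x*y + f∘l(y) - g∘l(x), where (f∘l(y))(z) = f(y*z), the ternary operation {x+f, y+g, z+h} := [[x,y,z]] + f∘R(z,y) - g∘R(z,x) + h∘L(y,x), where (f∘R(z,y))(u) = f([[u,z,y]]) and (h∘L(y,x))(u) = h([[y,x,u]]), and the form b̃(x+f,y+g) := f(y) + g(x). Then (T ⊕ T*, ∘, {·,·,·}) is a left Bol algebra and b̃ is a nondegenerate symmetric bilinear form on it satisfying b̃((X)∘(Y),Z) = b̃(X,(Y)∘(Z)) and b̃({X,Y,Z},U) = b̃({Z,U,X},Y) for all X,Y,Z,U ∈ T ⊕ T*; i.e. the trivial T*-extension of (T,b) is a quadratic left Bol algebra. -/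

import Mathlib

/-- A left Bol algebra over ℝ: a real vector space with a bilinear operation `mul`
and a trilinear operation `tri` satisfying (T01), (T02), (T1), (T2) and (T3). -/
structure LeftBolAlgebra (T : Type*) [AddCommGroup T] [Module ℝ T] where
  mul : T →ₗ[ℝ] T →ₗ[ℝ] T
  tri : T →ₗ[ℝ] T →ₗ[ℝ] T →ₗ[ℝ] T
  mul_anticomm : ∀ x y : T, mul x y = - mul y x
  tri_skew : ∀ x y z : T, tri x y z = - tri y x z
  tri_cyclic : ∀ x y z : T, tri x y z + tri y z x + tri z x y = 0
  tri_leibniz : ∀ u v x y z : T,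
    tri u v (tri x y z) = tri (tri u v x) y z + tri x (tri u v y) z + tri x y (tri u v z)
  bol : ∀ u v x y : T, tri u v (mul x y) =
    mul (tri u v x) y + mul x (tri u v y) + tri x y (mul u v) - mul (mul x y) (mul u v)

variable {T : Type*} [AddCommGroup T] [Module ℝ T]

/-- The adjoint map R(u,v) : w ↦ [[w,u,v]]. -/
def LeftBolAlgebra.Rmap (A : LeftBolAlgebra T) (u v : T) : T →ₗ[ℝ] T where
  toFun w := A.tri w u v
  map_add' a c := by simp
  map_smul' r a := by simp

/-- The form b̃ on T ⊕ T* given by b̃(x+f, y+g) = f(y) + g(x). -/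
def btilde (p q : T × Module.Dual ℝ T) : ℝ :=
  p.2 q.1 + q.2 p.1

namespace LeftBolAlgebra

variable (A : LeftBolAlgebra T)

@[simp] lemma Rmap_apply (u v w : T) : A.Rmap u v w = A.tri w u v := rfl

/-- The binary operation of the trivial T*-extension. -/
def mulExt : (T × Module.Dual ℝ T) →ₗ[ℝ] (T × Module.Dual ℝ T) →ₗ[ℝ] (T × Module.Dual ℝ T) :=
  LinearMap.mk₂ ℝ (fun p q => (A.mul p.1 q.1, p.2 ∘ₗ A.mul q.1 - q.2 ∘ₗ A.mul p.1))
    (fun p p' q => by ext <;> simp; ring)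
    (fun c p q => by ext <;> simp; ring)
    (fun p q q' => by ext <;> simp; ring)
    (fun c p q => by ext <;> simp; ring)

lemma mulExt_apply (p q : T × Module.Dual ℝ T) :
    A.mulExt p q = (A.mul p.1 q.1, p.2 ∘ₗ A.mul q.1 - q.2 ∘ₗ A.mul p.1) := rfl

/-- The ternary operation of the trivial T*-extension. -/
def triExt : (T × Module.Dual ℝ T) →ₗ[ℝ] (T × Module.Dual ℝ T) →ₗ[ℝ]
    (T × Module.Dual ℝ T) →ₗ[ℝ] (T × Module.Dual ℝ T) where
  toFun p := LinearMap.mk₂ ℝ (fun q r => (A.tri p.1 q.1 r.1,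
      p.2 ∘ₗ A.Rmap r.1 q.1 - q.2 ∘ₗ A.Rmap r.1 p.1 + r.2 ∘ₗ A.tri q.1 p.1))
    (fun q q' r => by ext <;> simp; ring)
    (fun c q r => by ext <;> simp; ring)
    (fun q r r' => by ext <;> simp; ring)
    (fun c q r => by ext <;> simp; ring)
  map_add' p p' := by
    refine LinearMap.ext₂ fun q r => ?_
    ext <;> simp; ring
  map_smul' c p := by
    refine LinearMap.ext₂ fun q r => ?_
    ext <;> simp; ring

lemma triExt_apply (p q r : T × Module.Dual ℝ T) :
    A.triExt p q r = (A.tri p.1 q.1 r.1,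
      p.2 ∘ₗ A.Rmap r.1 q.1 - q.2 ∘ₗ A.Rmap r.1 p.1 + r.2 ∘ₗ A.tri q.1 p.1) := rfl

variable {A} {b : LinearMap.BilinForm ℝ T}

lemma form_mul_right (hassoc : ∀ x y z : T, b (A.mul x y) z = b x (A.mul y z)) (w t y : T) :
    b w (A.mul t y) = b (A.mul y w) t := by
  rw [A.mul_anticomm, map_neg, ← hassoc, A.mul_anticomm w y, map_neg, LinearMap.neg_apply, neg_neg]

lemma form_tri_third (hsymm : ∀ x y : T, b x y = b y x)
    (hinv : ∀ x y z u : T, b (A.tri x y z) u = b (A.tri z u x) y) (w t u v : T) :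
    b w (A.tri u v t) = b (A.tri v u w) t := by
  rw [hsymm, hinv, A.tri_skew, map_neg, LinearMap.neg_apply, hinv, A.tri_skew v u, map_neg,
    LinearMap.neg_apply]

lemma form_tri_first (hsymm : ∀ x y : T, b x y = b y x)
    (hinv : ∀ x y z u : T, b (A.tri x y z) u = b (A.tri z u x) y) (w t u v : T) :
    b w (A.tri t u v) = b (A.tri w v u) t := by
  rw [form_tri_third hsymm hinv, hinv, A.tri_skew, map_neg, LinearMap.neg_apply, hsymm,
    form_tri_third hsymm hinv, A.tri_skew, map_neg, LinearMap.neg_apply, neg_neg]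

/-- In the presence of an invariant nondegenerate form, the derivation property of `tri` can be
transposed in its first argument. -/
lemma tri_tri_transpose (hsymm : ∀ x y : T, b x y = b y x)
    (hnondeg : ∀ x : T, (∀ y : T, b x y = 0) → x = 0)
    (hinv : ∀ x y z u : T, b (A.tri x y z) u = b (A.tri z u x) y) (t v x y z : T) :
    A.tri t (A.tri x y z) v =
      A.tri (A.tri t z y) x v - A.tri (A.tri t z x) y v + A.tri (A.tri y x t) z v := by
  refine sub_eq_zero.1 (hnondeg _ fun w => ?_)
  have hf := form_tri_first hsymm hinv
  have key := congrArg (b · t) (A.tri_leibniz w v x y z)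
  have h := congrArg (b · t) (A.tri_skew x (A.tri w v y) z)
  rw [hsymm]
  simp only [map_add, map_sub, map_neg, LinearMap.add_apply, LinearMap.neg_apply] at key h ⊢
  rw [hf w t, hf w (A.tri t z y), hf _ t, hf w (A.tri t z x), hf _ t,
    hf w (A.tri y x t), form_tri_third hsymm hinv _ t]
  linear_combination key + h

/-- In the presence of an invariant nondegenerate form, the Bol identity can be transposed in the
first argument of `tri`. -/
lemma tri_mul_transpose (hsymm : ∀ x y : T, b x y = b y x)
    (hnondeg : ∀ x : T, (∀ y : T, b x y = 0) → x = 0)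
    (hassoc : ∀ x y z : T, b (A.mul x y) z = b x (A.mul y z))
    (hinv : ∀ x y z u : T, b (A.tri x y z) u = b (A.tri z u x) y) (t v x y : T) :
    A.tri t (A.mul x y) v =
      A.tri (A.mul y t) x v - A.tri (A.mul x t) y v + A.mul v (A.tri y x t)
        + A.mul v (A.mul (A.mul x y) t) := by
  refine sub_eq_zero.1 (hnondeg _ fun w => ?_)
  have hf := form_tri_first hsymm hinv
  have key := congrArg (b · t) (A.bol w v x y)
  have h := congrArg (b · t) (A.mul_anticomm x (A.tri w v y))
  have h' := congrArg (b · t) (A.mul_anticomm (A.mul x y) (A.mul w v))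
  rw [hsymm]
  simp only [map_add, map_sub, map_neg, LinearMap.add_apply, LinearMap.sub_apply,
    LinearMap.neg_apply] at key h h' ⊢
  rw [hf w t, hf w (A.mul y t), hf w (A.mul x t), ← hassoc _ y t, ← hassoc _ x t,
    ← hassoc w v, ← hassoc w v, ← hassoc _ _ t, form_tri_third hsymm hinv _ t]
  linear_combination key + h - h'

/-- In the presence of an invariant nondegenerate form, the Bol identity can be transposed in an
argument of `mul`. -/
lemma mul_tri_transpose (hsymm : ∀ x y : T, b x y = b y x)
    (hnondeg : ∀ x : T, (∀ y : T, b x y = 0) → x = 0)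
    (hassoc : ∀ x y z : T, b (A.mul x y) z = b x (A.mul y z))
    (hinv : ∀ x y z u : T, b (A.tri x y z) u = b (A.tri z u x) y) (t u v y : T) :
    A.mul y (A.tri v u t) =
      A.tri v u (A.mul y t) + A.mul (A.tri u v y) t + A.tri t (A.mul u v) y
        - A.mul y (A.mul (A.mul u v) t) := by
  refine sub_eq_zero.1 (hnondeg _ fun w => ?_)
  have hl := form_tri_third hsymm hinv
  have key := congrArg (b · t) (A.bol u v w y)
  rw [hsymm]
  simp only [map_add, map_sub, LinearMap.add_apply, LinearMap.sub_apply] at key ⊢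
  rw [← hassoc w y, hl _ t, hl w (A.mul y t), ← hassoc _ y t, ← hassoc w _ t,
    form_tri_first hsymm hinv w t, ← hassoc w y, ← hassoc _ _ t]
  linear_combination key

end LeftBolAlgebra

/-- The trivial T*-extension of a quadratic left Bol algebra (T,b) is a quadratic left
Bol algebra: on T ⊕ T* the bilinear operation (x+f) ∘ (y+g) = x*y + f∘l(y) - g∘l(x)
and the trilinear operation
{x+f, y+g, z+h} = [[x,y,z]] + f∘R(z,y) - g∘R(z,x) + h∘L(y,x)
make T ⊕ T* a left Bol algebra, and b̃(x+f,y+g) = f(y) + g(x) is a nondegenerate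
symmetric bilinear form satisfying the associativity and right invariance conditions. -/
theorem trivial_Tstar_extension_quadratic_bol
    (A : LeftBolAlgebra T) (b : LinearMap.BilinForm ℝ T)
    (hsymm : ∀ x y : T, b x y = b y x)
    (hnondeg : ∀ x : T, (∀ y : T, b x y = 0) → x = 0)
    (hassoc : ∀ x y z : T, b (A.mul x y) z = b x (A.mul y z))
    (hinv : ∀ x y z u : T, b (A.tri x y z) u = b (A.tri z u x) y) :
    ∃ (mulE : (T × Module.Dual ℝ T) →ₗ[ℝ] (T × Module.Dual ℝ T) →ₗ[ℝ]
        (T × Module.Dual ℝ T))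
      (triE : (T × Module.Dual ℝ T) →ₗ[ℝ] (T × Module.Dual ℝ T) →ₗ[ℝ]
        (T × Module.Dual ℝ T) →ₗ[ℝ] (T × Module.Dual ℝ T)),
      (∀ p q : T × Module.Dual ℝ T,
        mulE p q = (A.mul p.1 q.1, p.2 ∘ₗ A.mul q.1 - q.2 ∘ₗ A.mul p.1)) ∧
      (∀ p q r : T × Module.Dual ℝ T,
        triE p q r = (A.tri p.1 q.1 r.1,
          p.2 ∘ₗ A.Rmap r.1 q.1 - q.2 ∘ₗ A.Rmap r.1 p.1 + r.2 ∘ₗ A.tri q.1 p.1)) ∧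
      (∀ p q : T × Module.Dual ℝ T, mulE p q = - mulE q p) ∧
      (∀ p q r : T × Module.Dual ℝ T, triE p q r = - triE q p r) ∧
      (∀ p q r : T × Module.Dual ℝ T, triE p q r + triE q r p + triE r p q = 0) ∧
      (∀ u v p q r : T × Module.Dual ℝ T, triE u v (triE p q r) =
        triE (triE u v p) q r + triE p (triE u v q) r + triE p q (triE u v r)) ∧
      (∀ u v p q : T × Module.Dual ℝ T, triE u v (mulE p q) =
        mulE (triE u v p) q + mulE p (triE u v q) + triE p q (mulE u v) -
          mulE (mulE p q) (mulE u v)) ∧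
      (∀ p q : T × Module.Dual ℝ T, btilde p q = btilde q p) ∧
      (∀ p : T × Module.Dual ℝ T, (∀ q : T × Module.Dual ℝ T, btilde p q = 0) → p = 0) ∧
      (∀ p q r : T × Module.Dual ℝ T, btilde (mulE p q) r = btilde p (mulE q r)) ∧
      (∀ p q r s : T × Module.Dual ℝ T,
        btilde (triE p q r) s = btilde (triE r s p) q) := by
  have sk := A.tri_skew
  have am := A.mul_anticomm
  refine ⟨A.mulExt, A.triExt, A.mulExt_apply, A.triExt_apply, ?_, ?_, ?_, ?_, ?_, ?_, ?_, ?_, ?_⟩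
  · rintro ⟨x, f⟩ ⟨y, g⟩
    refine Prod.ext (am x y) ?_
    simp [LeftBolAlgebra.mulExt_apply]
  · rintro ⟨x, f⟩ ⟨y, g⟩ ⟨z, h⟩
    refine Prod.ext (sk x y z) (LinearMap.ext fun t => ?_)
    have e := congrArg h (sk y x t)
    simp [LeftBolAlgebra.triExt_apply] at e ⊢
    linear_combination e
  · rintro ⟨x, f⟩ ⟨y, g⟩ ⟨z, h⟩
    refine Prod.ext (A.tri_cyclic x y z) (LinearMap.ext fun t => ?_)
    have e₁ := congrArg f (A.tri_cyclic t z y)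
    have e₂ := congrArg g (A.tri_cyclic t x z)
    have e₃ := congrArg h (A.tri_cyclic t y x)
    rw [sk y t z] at e₁
    rw [sk z t x] at e₂
    rw [sk x t y] at e₃
    simp [LeftBolAlgebra.triExt_apply] at e₁ e₂ e₃ ⊢
    linear_combination e₁ + e₂ + e₃
  · rintro ⟨u, k⟩ ⟨v, l⟩ ⟨x, f⟩ ⟨y, g⟩ ⟨z, h⟩
    refine Prod.ext (A.tri_leibniz u v x y z) (LinearMap.ext fun t => ?_)
    have tr := LeftBolAlgebra.tri_tri_transpose hsymm hnondeg hinv t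
    have ek := congrArg k (tr v x y z)
    have el := congrArg l (tr u x y z)
    have ef := congrArg f (A.tri_leibniz v u t z y)
    have eg := congrArg g (A.tri_leibniz v u t z x)
    have eh := congrArg h (A.tri_leibniz v u y x t)
    rw [sk v u y, sk v u z] at ef
    rw [sk v u x, sk v u z] at eg
    rw [sk v u y, sk v u x] at eh
    simp [LeftBolAlgebra.triExt_apply] at ek el ef eg eh ⊢
    linear_combination ek - el - ef + eg - eh
  · rintro ⟨u, k⟩ ⟨v, l⟩ ⟨x, f⟩ ⟨y, g⟩
    refine Prod.ext (A.bol u v x y) (LinearMap.ext fun t => ?_)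
    have tr := LeftBolAlgebra.tri_mul_transpose hsymm hnondeg hassoc hinv t
    have tr' := LeftBolAlgebra.mul_tri_transpose hsymm hnondeg hassoc hinv t
    have ek := congrArg k (tr v x y)
    have el := congrArg l (tr u x y)
    have ef := congrArg f (tr' u v y)
    have eg := congrArg g (tr' u v x)
    simp [LeftBolAlgebra.triExt_apply, LeftBolAlgebra.mulExt_apply] at ek el ef eg ⊢
    linear_combination ek - el + ef - eg
  · exact fun p q => add_comm _ _
  · rintro ⟨x, f⟩ h
    refine Prod.ext ?_ (LinearMap.ext fun t => ?_)
    · refine (Module.forall_dual_apply_eq_zero_iff ℝ x).1 fun g => ?_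
      simpa [btilde] using h (0, g)
    · simpa [btilde] using h (t, 0)
  · rintro ⟨x, f⟩ ⟨y, g⟩ ⟨z, h⟩
    have eg := congrArg g (am x z)
    have eh := congrArg h (am x y)
    simp [btilde, LeftBolAlgebra.mulExt_apply] at eg eh ⊢
    linear_combination -eg + eh
  · rintro ⟨x, f⟩ ⟨y, g⟩ ⟨z, h⟩ ⟨w, k⟩
    have eg := congrArg g (sk w z x)
    have ek := congrArg k (sk x y z)
    simp [btilde, LeftBolAlgebra.triExt_apply] at eg ek ⊢
    linear_combination -eg + ek
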